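/- Let π = (d_0,…,d_{n−1}) and π' = (d'_0,…,d'_{n−1}) be two tree degree sequences that differ only in two positions k < l, with d'_k = d_k + 1 and d'_l = d_l − 1, where d_k ≥ d_l > 1. If G is a tree with greatest spectral radius among all trees with degree sequence π, then there exists a tree G' with degree sequence π' such that λ(G') > λ(G). -/

import Mathlib

open Finset

variable {V : Type*} {W : Type*}

/-- The adjacency matrix of a finite simple graph, with real entries. -/
noncomputable def adjMat [Fintype V] (G : SimpleGraph V) : Matrix V V ℝ :=
  letI := Classical.decRel G.Adj
  G.adjMatrix ℝ

/-- The spectral radius `λ(G)`: the largest eigenvalue of the adjacency matrix. -/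
noncomputable def specRad [Fintype V] (G : SimpleGraph V) : ℝ :=
  sSup {μ : ℝ | ∃ f : V → ℝ, f ≠ 0 ∧ (adjMat G).mulVec f = μ • f}

/-- The degree of a vertex. -/
noncomputable def deg [Fintype V] (G : SimpleGraph V) (v : V) : ℕ :=
  letI := Classical.decRel G.Adj
  G.degree v

/-- The degree sequence of `G`, as a multiset. -/
noncomputable def degMultiset [Fintype V] (G : SimpleGraph V) : Multiset ℕ :=
  Finset.univ.val.map (deg G)

/-- `G` has the degree sequence `d` (a sequence of length `n`). -/
def hasDegSeq [Fintype V] (G : SimpleGraph V) {n : ℕ} (d : Fin n → ℕ) : Prop :=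
  Finset.univ.val.map d = degMultiset G

/-- `f` is the Perron vector of `G`: a positive unit eigenvector for the
largest eigenvalue. -/
def IsPerronVector [Fintype V] (G : SimpleGraph V) (f : V → ℝ) : Prop :=
  (∀ v, 0 < f v) ∧ (∑ v, f v ^ 2 = 1) ∧ (adjMat G).mulVec f = specRad G • f

/-- `N_f(v) = Σ_{u ∼ v} f(u)`. -/
noncomputable def Nf [Fintype V] (G : SimpleGraph V) (f : V → ℝ) (v : V) : ℝ :=
  letI := Classical.decRel G.Adj
  ∑ u ∈ G.neighborFinset v, f u

/-- `w` is the parent of `v` w.r.t. the ordering `ord` (with root `ord.symm 0`):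
`w` is the `ord`-least neighbor of `v` whose height is one less than that of `v`. -/
def IsParent [Fintype V] [Nonempty V] (G : SimpleGraph V)
    (ord : V ≃ Fin (Fintype.card V)) (w v : V) : Prop :=
  G.Adj w v ∧ G.dist (ord.symm ⟨0, Fintype.card_pos⟩) w + 1
      = G.dist (ord.symm ⟨0, Fintype.card_pos⟩) v ∧
    ∀ w' : V, G.Adj w' v →
      G.dist (ord.symm ⟨0, Fintype.card_pos⟩) w' + 1
        = G.dist (ord.symm ⟨0, Fintype.card_pos⟩) v → ord w ≤ ord w'

/-- `ord` is a breadth-first search ordering with decreasing degrees (BFD-ordering):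
vertices are listed layer by layer by distance from the root (the `ord`-least vertex),
(B1) children of earlier parents come before children of later parents, and
(B2) earlier vertices have larger or equal degrees. -/
def IsBFDOrdering [Fintype V] [Nonempty V] (G : SimpleGraph V)
    (ord : V ≃ Fin (Fintype.card V)) : Prop :=
  (∀ u v : V, ord u ≤ ord v →
      G.dist (ord.symm ⟨0, Fintype.card_pos⟩) u
        ≤ G.dist (ord.symm ⟨0, Fintype.card_pos⟩) v) ∧
  (∀ w1 w2 v1 v2 : V, ord w1 < ord w2 →
      IsParent G ord w1 v1 → IsParent G ord w2 v2 → ord v1 < ord v2) ∧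
  (∀ u v : V, ord u < ord v → deg G v ≤ deg G u)

/-- A tree degree sequence: non-increasing, positive entries, summing to `2(n-1)`. -/
def IsTreeDegSeq {n : ℕ} (d : Fin n → ℕ) : Prop :=
  Antitone d ∧ (∀ i, 0 < d i) ∧ ∑ i, d i = 2 * (n - 1)

/-- `Σ_{uv ∈ E(G)} f(u) f(v)`. -/
noncomputable def edgeSum [Fintype V] [DecidableEq V] (G : SimpleGraph V) (f : V → ℝ) : ℝ :=
  letI := Classical.decRel G.Adj
  ∑ e ∈ G.edgeFinset, Sym2.lift ⟨fun u v => f u * f v, fun u v => mul_comm (f u) (f v)⟩ e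

/-- The graph obtained from `G` by switching: replacing edges `v1u1`, `v2u2`
by `v1v2`, `u1u2`. -/
noncomputable def switched (G : SimpleGraph V) (v1 u1 v2 u2 : V) : SimpleGraph V :=
  SimpleGraph.fromEdgeSet ((G.edgeSet \ {s(v1, u1), s(v2, u2)}) ∪ {s(v1, v2), s(u1, u2)})

/-- The graph obtained from `G` by shifting: replacing the edge `uv1` by `uv2`. -/
noncomputable def shifted (G : SimpleGraph V) (u v1 v2 : V) : SimpleGraph V :=
  SimpleGraph.fromEdgeSet ((G.edgeSet \ {s(u, v1)}) ∪ {s(u, v2)})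

section Spectral

variable [Fintype V]

theorem adjMat_isHermitian (G : SimpleGraph V) : (adjMat G).IsHermitian := by
  classical
  ext i j
  simp [adjMat, SimpleGraph.adjMatrix_apply, G.adj_comm]

theorem finite_setOf_adjMat_eigenvalue (G : SimpleGraph V) :
    {μ : ℝ | ∃ f : V → ℝ, f ≠ 0 ∧ (adjMat G).mulVec f = μ • f}.Finite := by
  classical
  refine (Module.End.finite_hasEigenvalue (Matrix.toLin' (adjMat G))).subset ?_
  rintro μ ⟨f, hf, h⟩
  refine Module.End.hasEigenvalue_of_hasEigenvector (x := f) ⟨?_, hf⟩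
  rw [Module.End.mem_eigenspace_iff]
  simpa using h

theorem exists_eigenvector_specRad [Nonempty V] (G : SimpleGraph V) :
    ∃ f : V → ℝ, f ≠ 0 ∧ (adjMat G).mulVec f = specRad G • f := by
  classical
  have hA := adjMat_isHermitian G
  refine Set.Nonempty.csSup_mem ?_ (finite_setOf_adjMat_eigenvalue G)
  obtain ⟨i⟩ := ‹Nonempty V›
  refine ⟨hA.eigenvalues i, ⇑(hA.eigenvectorBasis i), ?_, hA.mulVec_eigenvectorBasis i⟩
  intro h
  refine hA.eigenvectorBasis.orthonormal.ne_zero i ?_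
  ext j
  exact congrFun h j

theorem posSemidef_specRad_sub_adjMat [DecidableEq V] (G : SimpleGraph V) :
    (specRad G • (1 : Matrix V V ℝ) - adjMat G).PosSemidef := by
  have hB : (specRad G • (1 : Matrix V V ℝ) - adjMat G).IsHermitian :=
    (Matrix.isHermitian_one.smul (IsSelfAdjoint.all _)).sub (adjMat_isHermitian G)
  rw [hB.posSemidef_iff_eigenvalues_nonneg]
  intro i
  have h := hB.mulVec_eigenvectorBasis i
  rw [Matrix.sub_mulVec, Matrix.smul_mulVec, Matrix.one_mulVec, sub_eq_iff_eq_add,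
    ← sub_eq_iff_eq_add', ← sub_smul] at h
  have hle := le_csSup (finite_setOf_adjMat_eigenvalue G).bddAbove
    ⟨⇑(hB.eigenvectorBasis i), fun h0 => hB.eigenvectorBasis.orthonormal.ne_zero i
      (by ext j; exact congrFun h0 j), h.symm⟩
  change _ ≤ specRad G at hle
  simpa using hle

theorem dotProduct_adjMat_mulVec_le (G : SimpleGraph V) (f : V → ℝ) :
    f ⬝ᵥ (adjMat G).mulVec f ≤ specRad G * (f ⬝ᵥ f) := by
  classical
  have h := (posSemidef_specRad_sub_adjMat G).dotProduct_mulVec_nonneg f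
  simp only [star_trivial, Matrix.sub_mulVec, Matrix.smul_mulVec, Matrix.one_mulVec,
    dotProduct_sub, dotProduct_smul, smul_eq_mul] at h
  linarith

/-- A vector attaining the maximum of the Rayleigh quotient is an eigenvector. -/
theorem adjMat_mulVec_eq_of_le (G : SimpleGraph V) (f : V → ℝ)
    (hf : specRad G * (f ⬝ᵥ f) ≤ f ⬝ᵥ (adjMat G).mulVec f) :
    (adjMat G).mulVec f = specRad G • f := by
  classical
  have h := (posSemidef_specRad_sub_adjMat G).dotProduct_mulVec_zero_iff f
  simp only [star_trivial, Matrix.sub_mulVec, Matrix.smul_mulVec, Matrix.one_mulVec,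
    dotProduct_sub, dotProduct_smul, smul_eq_mul] at h
  exact (sub_eq_zero.1 (h.1 (by linarith [dotProduct_adjMat_mulVec_le G f]))).symm

theorem adjMat_nonneg (G : SimpleGraph V) (i j : V) : 0 ≤ adjMat G i j := by
  classical
  simp only [adjMat, SimpleGraph.adjMatrix_apply]
  split_ifs <;> simp

theorem exists_pos_eigenvector [Nonempty V] {G : SimpleGraph V} (hG : G.Connected) :
    ∃ f : V → ℝ, (∀ v, 0 < f v) ∧ (adjMat G).mulVec f = specRad G • f := by
  classical
  obtain ⟨g, hg, hgA⟩ := exists_eigenvector_specRad G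
  have habs : (adjMat G).mulVec |g| = specRad G • |g| := by
    apply adjMat_mulVec_eq_of_le
    have h1 : (|g| ⬝ᵥ |g|) = g ⬝ᵥ g := by simp [dotProduct]
    have h2 : g ⬝ᵥ (adjMat G).mulVec g = specRad G * (g ⬝ᵥ g) := by
      rw [hgA, dotProduct_smul, smul_eq_mul]
    rw [h1, ← h2]
    simp only [dotProduct, Matrix.mulVec, Finset.mul_sum]
    refine Finset.sum_le_sum fun i _ => Finset.sum_le_sum fun j _ => ?_
    calc g i * (adjMat G i j * g j) ≤ |g i * (adjMat G i j * g j)| := le_abs_self _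
      _ = _ := by simp [abs_mul, abs_of_nonneg (adjMat_nonneg G i j)]
  refine ⟨|g|, fun v => (abs_nonneg (g v)).lt_of_ne' fun hv => hg ?_, habs⟩
  have step : ∀ a b, G.Adj a b → |g a| = 0 → |g b| = 0 := by
    intro a b hab ha
    have h := congrFun habs a
    simp only [Matrix.mulVec, dotProduct, Pi.smul_apply, Pi.abs_apply, ha, smul_zero] at h
    rw [Finset.sum_eq_zero_iff_of_nonneg
      (fun j _ => mul_nonneg (adjMat_nonneg G a j) (abs_nonneg _))] at h
    simpa [adjMat, SimpleGraph.adjMatrix_apply, hab] using h b (Finset.mem_univ b)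
  funext w
  obtain ⟨p⟩ := hG.preconnected v w
  clear hg hgA habs
  induction p with
  | nil => simpa using hv
  | cons h _ ih => exact ih (step _ _ h hv)

end Spectral

section Shift

/-- Replace the edge `ux` by the edge `vx`. -/
def moveEdge (G : SimpleGraph V) (u v x : V) : SimpleGraph V :=
  G.deleteEdges {s(u, x)} ⊔ SimpleGraph.edge v x

theorem moveEdge_adj {G : SimpleGraph V} {u v x a b : V} :
    (moveEdge G u v x).Adj a b ↔
      (G.Adj a b ∧ ¬ (a = u ∧ b = x ∨ a = x ∧ b = u)) ∨
        (a = v ∧ b = x ∨ a = x ∧ b = v) ∧ a ≠ b := by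
  simp [moveEdge, SimpleGraph.edge_adj]

theorem not_reachable_deleteEdges {G : SimpleGraph V} (hG : G.IsTree) {u v x : V}
    (hux : G.Adj u x) (huv : (G.deleteEdges {s(u, x)}).Reachable u v) :
    ¬ (G.deleteEdges {s(u, x)}).Reachable v x := fun h =>
  SimpleGraph.isBridge_iff.1
    (SimpleGraph.isAcyclic_iff_forall_adj_isBridge.1 hG.isAcyclic hux) (huv.trans h)

theorem isTree_moveEdge {G : SimpleGraph V} (hG : G.IsTree) {u v x : V}
    (hux : G.Adj u x) (huv : (G.deleteEdges {s(u, x)}).Reachable u v) :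
    (moveEdge G u v x).IsTree := by
  have hvx := not_reachable_deleteEdges hG hux huv
  have hne : v ≠ x := fun h => hvx (h ▸ .rfl)
  have hconn := hG.connected
  have := hconn.nonempty
  refine ⟨⟨fun a b => ?_⟩, ?_⟩
  · have hux' : (moveEdge G u v x).Reachable u x := by
      refine (huv.mono le_sup_left).trans (SimpleGraph.Adj.reachable ?_)
      exact Or.inr (by simp [SimpleGraph.edge_adj, hne])
    obtain ⟨p⟩ := hconn.preconnected a b
    induction p with
    | nil => rfl
    | @cons a c _ h _ ih =>
      refine SimpleGraph.Reachable.trans ?_ ih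
      by_cases hac : s(a, c) = s(u, x)
      · rcases Sym2.eq_iff.1 hac with ⟨rfl, rfl⟩ | ⟨rfl, rfl⟩
        · exact hux'
        · exact hux'.symm
      · exact SimpleGraph.Adj.reachable
          (Or.inl (by simpa [SimpleGraph.deleteEdges_adj, h] using hac))
  · exact (SimpleGraph.isAcyclic_add_edge_iff_of_not_reachable _ _ hvx).2
      (hG.isAcyclic.anti (SimpleGraph.deleteEdges_le _))

variable [Fintype V]

theorem adjMat_moveEdge_mulVec [DecidableEq V] {G : SimpleGraph V} (hG : G.IsTree) {u v x : V}
    (hux : G.Adj u x) (huv : (G.deleteEdges {s(u, x)}).Reachable u v) (hne : u ≠ v)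
    (g : V → ℝ) :
    (adjMat (moveEdge G u v x)).mulVec g = (adjMat G).mulVec g +
      (Pi.single v (g x) - Pi.single u (g x) + Pi.single x (g v - g u)) := by
  have hvx := not_reachable_deleteEdges hG hux huv
  have hvx' : v ≠ x := fun h => hvx (h ▸ .rfl)
  have hnadj : ¬ G.Adj v x := fun h => hvx (SimpleGraph.Adj.reachable (by
    simp [SimpleGraph.deleteEdges_adj, h, hne.symm, hvx']))
  have hux' := hux.ne
  have key : adjMat (moveEdge G u v x) = adjMat G +
      (Matrix.single v x 1 - Matrix.single u x 1 +
        (Matrix.single x v 1 - Matrix.single x u 1)) := by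
    ext a b
    have hxu := hux.symm
    have hnadj' : ¬ G.Adj x v := fun h => hnadj h.symm
    simp only [adjMat, SimpleGraph.adjMatrix_apply, Matrix.add_apply, Matrix.sub_apply,
      Matrix.single_apply]
    by_cases hab : G.Adj a b <;> by_cases h1 : a = v <;> by_cases h2 : a = x <;>
      by_cases h3 : a = u <;> by_cases h4 : b = v <;> by_cases h5 : b = x <;>
      by_cases h6 : b = u <;> subst_vars <;> simp_all [eq_comm, moveEdge_adj]
  rw [key]
  ext w
  simp only [Matrix.add_mulVec, Matrix.sub_mulVec, Matrix.single_mulVec, Pi.add_apply,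
    Pi.sub_apply, Pi.single_apply]
  simp [Function.update_apply]
  split_ifs <;> ring

theorem deg_eq_adjMat_mulVec_one (G : SimpleGraph V) (v : V) :
    (deg G v : ℝ) = (adjMat G).mulVec 1 v := by
  classical
  simp [deg, adjMat, SimpleGraph.adjMatrix_mulVec_apply]

theorem exists_adj_reachable_deleteEdges {G : SimpleGraph V} (hG : G.Connected) {u v : V}
    (hdeg : 1 < deg G u) :
    ∃ x, G.Adj u x ∧ (G.deleteEdges {s(u, x)}).Reachable u v := by
  classical
  obtain ⟨p, hp⟩ := hG.exists_isPath u v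
  obtain ⟨x, hx, hxp⟩ := Finset.exists_mem_ne (s := G.neighborFinset u)
    (by simpa [deg] using hdeg) p.snd
  refine ⟨x, by simpa using hx, ⟨p.toDeleteEdge _ fun h => hxp (hp.eq_snd_of_mem_edges h)⟩⟩

/-- Moving `m` edges of a tree from `u` to `v`, where `f u ≤ f v` for a positive vector `f`,
does not decrease the quadratic form at `f`. -/
theorem exists_isTree_moveEdges {G : SimpleGraph V} (hG : G.IsTree) {u v : V} (hne : u ≠ v)
    {f : V → ℝ} (hpos : ∀ w, 0 < f w) (hf : f u ≤ f v) (m : ℕ) (hm : m < deg G u) :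
    ∃ H : SimpleGraph V, H.IsTree ∧ deg H u + m = deg G u ∧ deg H v = deg G v + m ∧
      (∀ w, w ≠ u → w ≠ v → deg H w = deg G w) ∧
      f ⬝ᵥ (adjMat G).mulVec f ≤ f ⬝ᵥ (adjMat H).mulVec f ∧
      (adjMat G).mulVec f v ≤ (adjMat H).mulVec f v ∧
      (0 < m → (adjMat G).mulVec f v < (adjMat H).mulVec f v) := by
  classical
  induction m with
  | zero => exact ⟨G, hG, rfl, rfl, fun _ _ _ => rfl, le_rfl, le_rfl, fun h => h.false.elim⟩
  | succ m ih =>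
    obtain ⟨H, hH, hu, hv, hw, hq, hle, -⟩ := ih (by omega)
    obtain ⟨x, hux, hr⟩ := exists_adj_reachable_deleteEdges (v := v) hH.connected
      (show 1 < deg H u by omega)
    have hvx : v ≠ x := fun h => not_reachable_deleteEdges hH hux hr (h ▸ .rfl)
    have hmul := adjMat_moveEdge_mulVec hH hux hr hne
    have hdeg (w : V) : (deg (moveEdge H u v x) w : ℝ) =
        deg H w + ((if w = v then 1 else 0) - (if w = u then 1 else 0)) := by
      simp [deg_eq_adjMat_mulVec_one, hmul, Pi.single_apply]
    have hlt : (adjMat G).mulVec f v < (adjMat (moveEdge H u v x)).mulVec f v := by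
      have := hpos x
      simp only [hmul, Pi.add_apply, Pi.sub_apply, Pi.single_eq_same,
        Pi.single_eq_of_ne hne.symm, Pi.single_eq_of_ne hvx]
      linarith
    refine ⟨moveEdge H u v x, isTree_moveEdge hH hux hr, ?_, ?_, ?_, ?_, hlt.le, fun _ => hlt⟩
    · have h := hdeg u
      simp only [hne, if_true, if_false] at h
      have : deg (moveEdge H u v x) u + 1 = deg H u := by
        exact_mod_cast (by linarith : (deg (moveEdge H u v x) u : ℝ) + 1 = deg H u)
      omega
    · have h := hdeg v
      simp only [hne.symm, if_true, if_false, sub_zero] at h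
      have : deg (moveEdge H u v x) v = deg H v + 1 := by exact_mod_cast h
      omega
    · intro w hwu hwv
      have h := hdeg w
      simp only [hwu, hwv, if_false, sub_zero, add_zero] at h
      rw [← hw w hwu hwv]
      exact_mod_cast h
    · refine hq.trans ?_
      simp only [hmul, dotProduct_add, dotProduct_sub, dotProduct_single]
      nlinarith [mul_nonneg (hpos x).le (sub_nonneg.2 hf)]

/-- If `f` is a positive eigenvector of a tree for its spectral radius and
`f u ≤ f v`, then `m < deg u` edges can be moved from `u` to `v` so that the spectral
radius increases. -/
theorem exists_isTree_specRad_lt {G : SimpleGraph V} (hG : G.IsTree) {u v : V} (hne : u ≠ v)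
    {f : V → ℝ} (hpos : ∀ w, 0 < f w) (hfA : (adjMat G).mulVec f = specRad G • f)
    (hf : f u ≤ f v) {m : ℕ} (hm0 : 0 < m) (hm : m < deg G u) :
    ∃ H : SimpleGraph V, H.IsTree ∧ deg H u + m = deg G u ∧ deg H v = deg G v + m ∧
      (∀ w, w ≠ u → w ≠ v → deg H w = deg G w) ∧ specRad G < specRad H := by
  obtain ⟨H, hH, hu, hv, hw, hq, -, hlt⟩ := exists_isTree_moveEdges hG hne hpos hf m hm
  refine ⟨H, hH, hu, hv, hw, lt_of_not_ge fun hle => ?_⟩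
  have hff : 0 < f ⬝ᵥ f :=
    Finset.sum_pos (fun w _ => mul_pos (hpos w) (hpos w)) ⟨u, Finset.mem_univ u⟩
  rw [hfA, dotProduct_smul, smul_eq_mul] at hq
  have hHf := adjMat_mulVec_eq_of_le H f ((mul_le_mul_of_nonneg_right hle hff.le).trans hq)
  have h := hlt hm0
  rw [hHf, hfA] at h
  simp only [Pi.smul_apply, smul_eq_mul] at h
  exact (mul_le_mul_of_nonneg_right hle (hpos v).le).not_gt h

end Shift

theorem exists_equiv_of_hasDegSeq {n : ℕ} [Fintype V] {G : SimpleGraph V} {d : Fin n → ℕ}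
    (h : hasDegSeq G d) : ∃ e : Fin n ≃ V, ∀ i, deg G (e i) = d i := by
  classical
  have hcard (c : ℕ) : Fintype.card {i // d i = c} = Fintype.card {v // deg G v = c} := by
    have := congrArg (Multiset.count c) h
    simpa [degMultiset, Multiset.count_map, Fintype.card_subtype, Finset.card_def, eq_comm,
      -Fin.univ_val_map] using this
  let e := Equiv.ofFiberEquiv fun c => Fintype.equivOfCardEq (hcard c)
  exact ⟨e, fun i => Equiv.ofFiberEquiv_map _ i⟩

theorem hasDegSeq_of_equiv {n : ℕ} [Fintype V] {G : SimpleGraph V} {d : Fin n → ℕ}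
    (e : Fin n ≃ V) (h : ∀ i, deg G (e i) = d i) : hasDegSeq G d := by
  rw [hasDegSeq, degMultiset, ← Multiset.map_univ_val_equiv e, Multiset.map_map]
  exact Multiset.map_congr rfl fun i _ => (h i).symm

/-- If tree degree sequences `d ◁ d'` differ only in positions
`k < l` with `d'_k = d_k + 1` and `d'_l = d_l − 1` (where `d_l > 1`), and `G` is a
tree of greatest spectral radius with degree sequence `d`, then some tree `G'` with
degree sequence `d'` has `λ(G') > λ(G)`. -/
theorem single_step_majorization {n : ℕ}
    (d d' : Fin n → ℕ) (hd : IsTreeDegSeq d) (hd' : IsTreeDegSeq d')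
    (k l : Fin n) (hkl : k < l)
    (hk : d' k = d k + 1) (hl : d l = d' l + 1) (hl1 : 1 < d l)
    (hoth : ∀ i : Fin n, i ≠ k → i ≠ l → d' i = d i)
    (G : SimpleGraph (Fin n)) (hG : G.IsTree) (hGd : hasDegSeq G d)
    (hGmax : ∀ H : SimpleGraph (Fin n), H.IsTree → hasDegSeq H d →
      specRad H ≤ specRad G) :
    ∃ G' : SimpleGraph (Fin n), G'.IsTree ∧ hasDegSeq G' d' ∧
      specRad G < specRad G' := by
  obtain ⟨e, he⟩ := exists_equiv_of_hasDegSeq hGd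
  have : Nonempty (Fin n) := ⟨k⟩
  obtain ⟨f, hpos, hfA⟩ := exists_pos_eigenvector hG.connected
  have hne : e l ≠ e k := e.injective.ne hkl.ne'
  have hdkl : d l ≤ d k := hd.1 hkl.le
  have hel := he l
  have hek := he k
  have hoth' (i : Fin n) (hik : i ≠ k) (hil : i ≠ l) : d' i = deg G (e i) := by
    rw [hoth i hik hil, he i]
  rcases le_total (f (e l)) (f (e k)) with hf | hf
  · obtain ⟨H, hH, hu, hv, hw, hlt⟩ :=
      exists_isTree_specRad_lt hG hne hpos hfA hf zero_lt_one (by omega)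
    refine ⟨H, hH, hasDegSeq_of_equiv e fun i => ?_, hlt⟩
    rcases eq_or_ne i k with rfl | hik
    · omega
    rcases eq_or_ne i l with rfl | hil
    · omega
    rw [hw _ (e.injective.ne hil) (e.injective.ne hik), hoth' i hik hil]
  · obtain ⟨H, hH, hu, hv, hw, hlt⟩ :=
      exists_isTree_specRad_lt hG hne.symm hpos hfA hf (m := d k - d l + 1) (by omega) (by omega)
    refine ⟨H, hH, hasDegSeq_of_equiv ((Equiv.swap k l).trans e) fun i => ?_, hlt⟩
    rw [Equiv.trans_apply]
    rcases eq_or_ne i k with rfl | hik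
    · rw [Equiv.swap_apply_left]
      omega
    rcases eq_or_ne i l with rfl | hil
    · rw [Equiv.swap_apply_right]
      omega
    rw [Equiv.swap_apply_of_ne_of_ne hik hil, hw _ (e.injective.ne hik) (e.injective.ne hil),
      hoth' i hik hil]
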